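/- Let n ≥ 1 and let U be a 2^n×2^n unitary matrix with Pauli-basis representation matrix M^U. Then: (1) for every 0 < p < 2 and 0 < q ≤ ∞, ‖M^U‖_{p,q} ≥ 1, with equality if and only if U is a Clifford unitary; (2) for every p > 2 and 0 < q < ∞, ‖M^U‖_{p,q} ≤ 1, with equality if and only if U is a Clifford unitary; (3) for p = 2 and any q > 0, and also for p > 2 with q = ∞, ‖M^U‖_{p,q} = 1 for every unitary U. -/

import Mathlib

open scoped ENNReal BigOperators
open Matrix

/-- The `l_p` norm of a finitely-indexed real vector, for `0 < p ≤ ∞`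
(for `p = ∞` it is the max of the absolute values of the entries). -/
noncomputable def vecLpNorm {ι : Type*} [Fintype ι] (p : ℝ≥0∞) (w : ι → ℝ) : ℝ :=
  if p = ∞ then ⨆ j, |w j| else (∑ j, |w j| ^ p.toReal) ^ (1 / p.toReal)

/-- The `(p,q)` group norm of a real matrix:
`‖M‖_{p,q} = ((1/N₁) ∑_i ‖M_i‖_p^q)^{1/q}`, with `‖M‖_{p,∞} = max_i ‖M_i‖_p`. -/
noncomputable def groupNorm {ι κ : Type*} [Fintype ι] [Fintype κ]
    (p q : ℝ≥0∞) (M : Matrix ι κ ℝ) : ℝ :=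
  if q = ∞ then ⨆ i, vecLpNorm p (M i)
  else ((Fintype.card ι : ℝ)⁻¹ * ∑ i, vecLpNorm p (M i) ^ q.toReal) ^ (1 / q.toReal)

/-- The single-qubit Pauli matrices `I, X, Y, Z`. -/
noncomputable def pauli1 : Fin 4 → Matrix (Fin 2) (Fin 2) ℂ
  | 0 => 1
  | 1 => !![0, 1; 1, 0]
  | 2 => !![0, -Complex.I; Complex.I, 0]
  | 3 => !![1, 0; 0, -1]

/-- The `n`-qubit Pauli operator `P_z = P_{z₁} ⊗ ⋯ ⊗ P_{z_n}`, realized as a matrix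
on the `2^n`-dimensional space indexed by `Fin n → Fin 2`. -/
noncomputable def pauliN (n : ℕ) (z : Fin n → Fin 4) :
    Matrix (Fin n → Fin 2) (Fin n → Fin 2) ℂ :=
  Matrix.of fun a b => ∏ i, pauli1 (z i) (a i) (b i)

/-- The Pauli-basis representation matrix of (conjugation by) a `2^n × 2^n` unitary `U`:
`M^U_{z,x} = (1/2^n)·Tr(P_z U P_x U†)` (these traces are real). -/
noncomputable def repU {n : ℕ} (U : Matrix (Fin n → Fin 2) (Fin n → Fin 2) ℂ) :
    Matrix (Fin n → Fin 4) (Fin n → Fin 4) ℝ :=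
  Matrix.of fun z x => ((1 / 2 ^ n : ℂ) * (pauliN n z * (U * pauliN n x * Uᴴ)).trace).re

/-- `U` is a Clifford unitary: it maps every Pauli operator to a Pauli operator up to sign. -/
def IsCliffordU {n : ℕ} (U : Matrix (Fin n → Fin 2) (Fin n → Fin 2) ℂ) : Prop :=
  ∀ x : Fin n → Fin 4, ∃ (z : Fin n → Fin 4) (s : ℝ),
    (s = 1 ∨ s = -1) ∧ U * pauliN n x * Uᴴ = (s : ℂ) • pauliN n z

section RealVectors

theorem Real.rpow_eq_rpow_iff_of_le_one {a s t : ℝ} (ha : 0 ≤ a) (ha1 : a ≤ 1)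
    (hs : 0 < s) (ht : 0 < t) (hst : s ≠ t) : a ^ s = a ^ t ↔ a = 0 ∨ a = 1 := by
  constructor
  · intro h
    by_contra! hc
    have h0 : 0 < a := lt_of_le_of_ne ha hc.1.symm
    have h1 : a < 1 := lt_of_le_of_ne ha1 hc.2
    rcases lt_or_gt_of_ne hst with hlt | hlt
    · exact (Real.rpow_lt_rpow_of_exponent_gt h0 h1 hlt).ne' h
    · exact (Real.rpow_lt_rpow_of_exponent_gt h0 h1 hlt).ne h
  · rintro (rfl | rfl)
    · rw [Real.zero_rpow hs.ne', Real.zero_rpow ht.ne']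
    · simp

variable {ι κ : Type*} [Fintype ι] [Fintype κ] {w : ι → ℝ}

theorem abs_le_one_of_sum_sq_eq_one (hw : ∑ j, w j ^ 2 = 1) (j : ι) : |w j| ≤ 1 := by
  rw [← sq_le_one_iff_abs_le_one, ← hw]
  exact Finset.single_le_sum (f := fun j => w j ^ 2) (fun i _ => sq_nonneg _) (Finset.mem_univ j)

theorem eq_zero_of_sum_sq_eq_one (hw : ∑ j, w j ^ 2 = 1) {j k : ι} (hj : |w j| = 1)
    (hk : k ≠ j) : w k = 0 := by
  classical
  have hsq : w j ^ 2 = 1 := by rw [← sq_abs, hj, one_pow]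
  rw [← Finset.add_sum_erase _ _ (Finset.mem_univ j), hsq, add_eq_left,
    Finset.sum_eq_zero_iff_of_nonneg fun i _ => sq_nonneg _] at hw
  simpa using hw k (Finset.mem_erase.2 ⟨hk, Finset.mem_univ k⟩)

theorem exists_ne_zero_of_sum_sq_eq_one (hw : ∑ j, w j ^ 2 = 1) : ∃ j, w j ≠ 0 := by
  by_contra! h
  simp [h] at hw

theorem sum_abs_rpow_two (hw : ∑ j, w j ^ 2 = 1) : ∑ j, |w j| ^ (2 : ℝ) = 1 := by
  simpa [Real.rpow_two] using hw

theorem one_le_sum_abs_rpow (hw : ∑ j, w j ^ 2 = 1) {t : ℝ} (ht2 : t ≤ 2) :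
    1 ≤ ∑ j, |w j| ^ t := by
  rw [← sum_abs_rpow_two hw]
  exact Finset.sum_le_sum fun j _ => Real.rpow_le_rpow_of_exponent_ge_of_imp (abs_nonneg _)
    (abs_le_one_of_sum_sq_eq_one hw j) ht2 fun _ h => absurd h two_ne_zero

theorem sum_abs_rpow_le_one (hw : ∑ j, w j ^ 2 = 1) {t : ℝ} (ht : 2 ≤ t) :
    ∑ j, |w j| ^ t ≤ 1 := by
  rw [← sum_abs_rpow_two hw]
  exact Finset.sum_le_sum fun j _ => Real.rpow_le_rpow_of_exponent_ge_of_imp (abs_nonneg _)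
    (abs_le_one_of_sum_sq_eq_one hw j) ht fun _ h => absurd h (two_pos.trans_le ht).ne'

theorem sum_abs_rpow_eq_one_iff (hw : ∑ j, w j ^ 2 = 1) {t : ℝ} (ht : 0 < t) (ht2 : t ≠ 2) :
    ∑ j, |w j| ^ t = 1 ↔ ∀ j, w j = 0 ∨ |w j| = 1 := by
  have key (j : ι) : |w j| ^ t = |w j| ^ (2 : ℝ) ↔ w j = 0 ∨ |w j| = 1 := by
    rw [Real.rpow_eq_rpow_iff_of_le_one (abs_nonneg _) (abs_le_one_of_sum_sq_eq_one hw j) ht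
      two_pos ht2, abs_eq_zero]
  simp_rw [← key]
  rw [← sum_abs_rpow_two hw]
  rcases le_total t 2 with h | h
  · rw [eq_comm, Finset.sum_eq_sum_iff_of_le fun j _ =>
      Real.rpow_le_rpow_of_exponent_ge_of_imp (abs_nonneg _)
        (abs_le_one_of_sum_sq_eq_one hw j) h fun _ h => absurd h two_ne_zero]
    simp [eq_comm]
  · rw [Finset.sum_eq_sum_iff_of_le fun j _ =>
      Real.rpow_le_rpow_of_exponent_ge_of_imp (abs_nonneg _)
        (abs_le_one_of_sum_sq_eq_one hw j) h fun _ h => absurd h ht.ne']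
    simp

theorem Real.rpow_eq_one_iff_of_nonneg {a t : ℝ} (ha : 0 ≤ a) (ht : t ≠ 0) :
    a ^ t = 1 ↔ a = 1 := by
  rw [← Real.rpow_left_inj ha zero_le_one ht, Real.one_rpow]

theorem vecLpNorm_nonneg (p : ℝ≥0∞) (w : ι → ℝ) : 0 ≤ vecLpNorm p w := by
  unfold vecLpNorm
  split_ifs
  · exact Real.iSup_nonneg fun j => abs_nonneg _
  · positivity

theorem vecLpNorm_two (hw : ∑ j, w j ^ 2 = 1) : vecLpNorm 2 w = 1 := by
  simp [vecLpNorm, hw]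

theorem one_le_vecLpNorm (hw : ∑ j, w j ^ 2 = 1) {p : ℝ≥0∞} (hp : 0 < p) (hp2 : p < 2) :
    1 ≤ vecLpNorm p w ∧ (vecLpNorm p w = 1 ↔ ∀ j, w j = 0 ∨ |w j| = 1) := by
  have hpt : p ≠ ∞ := (hp2.trans ENNReal.ofNat_lt_top).ne
  have h0 : 0 < p.toReal := ENNReal.toReal_pos hp.ne' hpt
  have h2 : p.toReal < 2 := by simpa using ENNReal.toReal_strict_mono ENNReal.ofNat_ne_top hp2
  rw [vecLpNorm, if_neg hpt, Real.rpow_eq_one_iff_of_nonneg (by positivity) (by positivity)]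
  exact ⟨Real.one_le_rpow (one_le_sum_abs_rpow hw h2.le) (by positivity),
    sum_abs_rpow_eq_one_iff hw h0 h2.ne⟩

theorem vecLpNorm_le_one (hw : ∑ j, w j ^ 2 = 1) {p : ℝ≥0∞} (hp : 2 < p) :
    vecLpNorm p w ≤ 1 ∧ (vecLpNorm p w = 1 ↔ ∀ j, w j = 0 ∨ |w j| = 1) := by
  unfold vecLpNorm
  split_ifs with hpt
  · obtain ⟨j₀, hj₀⟩ := exists_ne_zero_of_sum_sq_eq_one hw
    have : Nonempty ι := ⟨j₀⟩
    refine ⟨ciSup_le (abs_le_one_of_sum_sq_eq_one hw), fun h j => ?_, fun h => ?_⟩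
    · obtain ⟨k, hk⟩ := exists_eq_ciSup_of_finite (f := fun j => |w j|)
      rw [h] at hk
      by_cases hjk : j = k
      · exact Or.inr (hjk ▸ hk)
      · exact Or.inl (eq_zero_of_sum_sq_eq_one hw hk hjk)
    · refine le_antisymm (ciSup_le (abs_le_one_of_sum_sq_eq_one hw)) ?_
      rw [← (h j₀).resolve_left hj₀]
      exact le_ciSup (f := fun j => |w j|) (Set.finite_range _).bddAbove j₀
  · have h2 : 2 < p.toReal := by simpa using ENNReal.toReal_strict_mono hpt hp
    have h0 : 0 < p.toReal := two_pos.trans h2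
    rw [Real.rpow_eq_one_iff_of_nonneg (by positivity) (by positivity)]
    exact ⟨Real.rpow_le_one (by positivity) (sum_abs_rpow_le_one hw h2.le) (by positivity),
      sum_abs_rpow_eq_one_iff hw h0 h2.ne'⟩

theorem inv_card_mul_sum_eq_one_iff [Nonempty ι] {f : ι → ℝ} :
    (Fintype.card ι : ℝ)⁻¹ * ∑ i, f i = 1 ↔ ∑ i, f i = ∑ _i : ι, 1 := by
  rw [inv_mul_eq_one₀ (by simp), eq_comm]
  simp

theorem one_le_groupNorm [Nonempty ι] {p q : ℝ≥0∞} (hq : 0 < q) {M : Matrix ι κ ℝ}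
    (hM : ∀ i, 1 ≤ vecLpNorm p (M i)) :
    1 ≤ groupNorm p q M ∧ (groupNorm p q M = 1 ↔ ∀ i, vecLpNorm p (M i) = 1) := by
  unfold groupNorm
  split_ifs with hqt
  · have hle (i : ι) : vecLpNorm p (M i) ≤ ⨆ i, vecLpNorm p (M i) :=
      le_ciSup (Set.finite_range fun i => vecLpNorm p (M i)).bddAbove i
    refine ⟨(hM (Classical.arbitrary ι)).trans (hle _), fun h i => ?_, fun h => by simp [h]⟩
    exact le_antisymm (h ▸ hle i) (hM i)
  · have h0 : 0 < q.toReal := ENNReal.toReal_pos hq.ne' hqt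
    have hle (i : ι) : 1 ≤ vecLpNorm p (M i) ^ q.toReal := Real.one_le_rpow (hM i) h0.le
    have hnn (i : ι) := vecLpNorm_nonneg p (M i)
    have hpow (i : ι) : 0 ≤ vecLpNorm p (M i) ^ q.toReal := zero_le_one.trans (hle i)
    have hsum : (0 : ℝ) ≤ ∑ i, vecLpNorm p (M i) ^ q.toReal := Finset.sum_nonneg fun i _ => hpow i
    constructor
    · refine Real.one_le_rpow ?_ (by positivity)
      rw [← div_eq_inv_mul, one_le_div (by simp [Fintype.card_pos])]
      simpa using Finset.sum_le_sum fun i (_ : i ∈ Finset.univ) => hle i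
    · rw [Real.rpow_eq_one_iff_of_nonneg (by positivity) (by positivity), inv_card_mul_sum_eq_one_iff, eq_comm,
        Finset.sum_eq_sum_iff_of_le fun i _ => hle i]
      simp [eq_comm (a := (1 : ℝ)), Real.rpow_eq_one_iff_of_nonneg (hnn _) h0.ne']

theorem groupNorm_le_one [Nonempty ι] {p q : ℝ≥0∞} (hq : 0 < q) (hqt : q ≠ ∞)
    {M : Matrix ι κ ℝ} (hM : ∀ i, vecLpNorm p (M i) ≤ 1) :
    groupNorm p q M ≤ 1 ∧ (groupNorm p q M = 1 ↔ ∀ i, vecLpNorm p (M i) = 1) := by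
  rw [groupNorm, if_neg hqt]
  have h0 : 0 < q.toReal := ENNReal.toReal_pos hq.ne' hqt
  have hnn (i : ι) := vecLpNorm_nonneg p (M i)
  have hle (i : ι) : vecLpNorm p (M i) ^ q.toReal ≤ 1 := Real.rpow_le_one (hnn i) (hM i) h0.le
  have hsum : (0 : ℝ) ≤ ∑ i, vecLpNorm p (M i) ^ q.toReal :=
    Finset.sum_nonneg fun i _ => Real.rpow_nonneg (hnn i) _
  constructor
  · refine Real.rpow_le_one (by positivity) ?_ (by positivity)
    rw [← div_eq_inv_mul, div_le_one (by simp [Fintype.card_pos])]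
    simpa using Finset.sum_le_sum fun i (_ : i ∈ Finset.univ) => hle i
  · rw [Real.rpow_eq_one_iff_of_nonneg (by positivity) (by positivity), inv_card_mul_sum_eq_one_iff,
      Finset.sum_eq_sum_iff_of_le fun i _ => hle i]
    simp [Real.rpow_eq_one_iff_of_nonneg (hnn _) h0.ne']

end RealVectors

section Pauli

theorem pauli1_conjTranspose (k : Fin 4) : (pauli1 k)ᴴ = pauli1 k := by
  ext a b
  fin_cases k <;> fin_cases a <;> fin_cases b <;> simp [pauli1]

theorem pauli1_mul_self (k : Fin 4) : pauli1 k * pauli1 k = 1 := by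
  ext a b
  fin_cases k <;> fin_cases a <;> fin_cases b <;> simp [pauli1, Matrix.mul_apply]

theorem trace_pauli1_mul (k l : Fin 4) :
    (pauli1 k * pauli1 l).trace = if k = l then 2 else 0 := by
  fin_cases k <;> fin_cases l <;>
    simp [pauli1, Matrix.trace, one_add_one_eq_two]

theorem sum_pauli1_mul_pauli1 (a b c d : Fin 2) :
    ∑ k, pauli1 k a b * pauli1 k c d = if a = d ∧ b = c then 2 else 0 := by
  fin_cases a <;> fin_cases b <;> fin_cases c <;> fin_cases d <;>
    simp [pauli1, Fin.sum_univ_four, one_add_one_eq_two]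

variable {n : ℕ}

theorem pauliN_zero : pauliN n (fun _ => 0) = 1 := by
  ext a b
  simp [pauliN, pauli1, Matrix.one_apply, Finset.prod_ite_zero, funext_iff]

theorem pauliN_conjTranspose (z : Fin n → Fin 4) : (pauliN n z)ᴴ = pauliN n z := by
  ext a b
  simp only [pauliN, Matrix.conjTranspose_apply, Matrix.of_apply, star_prod]
  exact Finset.prod_congr rfl fun i _ => congrFun₂ (pauli1_conjTranspose (z i)) (a i) (b i)

theorem pauliN_mul_apply (z w : Fin n → Fin 4) (a b : Fin n → Fin 2) :
    (pauliN n z * pauliN n w) a b = ∏ i, (pauli1 (z i) * pauli1 (w i)) (a i) (b i) := by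
  simp only [pauliN, Matrix.mul_apply, Matrix.of_apply, ← Finset.prod_mul_distrib]
  rw [Finset.prod_univ_sum, Fintype.piFinset_univ]

theorem pauliN_mul_self (z : Fin n → Fin 4) : pauliN n z * pauliN n z = 1 := by
  ext a b
  simp [pauliN_mul_apply, pauli1_mul_self, Matrix.one_apply, Finset.prod_ite_zero, funext_iff]

theorem trace_pauliN_mul (z w : Fin n → Fin 4) :
    (pauliN n z * pauliN n w).trace = if z = w then 2 ^ n else 0 := by
  simp only [Matrix.trace, Matrix.diag_apply, pauliN_mul_apply]
  rw [← Fintype.piFinset_univ, ← Finset.prod_univ_sum (fun _ => Finset.univ)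
    (fun i a => (pauli1 (z i) * pauli1 (w i)) a a)]
  change ∏ i, (pauli1 (z i) * pauli1 (w i)).trace = _
  simp [trace_pauli1_mul, Finset.prod_ite_zero, funext_iff]

theorem sum_pauliN_mul_pauliN (a b c d : Fin n → Fin 2) :
    ∑ z, pauliN n z a b * pauliN n z c d = if a = d ∧ b = c then 2 ^ n else 0 := by
  simp only [pauliN, Matrix.of_apply, ← Finset.prod_mul_distrib]
  rw [← Fintype.piFinset_univ, ← Finset.prod_univ_sum (fun _ => Finset.univ)
    (fun i k => pauli1 k (a i) (b i) * pauli1 k (c i) (d i))]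
  simp [sum_pauli1_mul_pauli1, Finset.prod_ite_zero, funext_iff, forall_and]

theorem sum_trace_smul_pauliN (A : Matrix (Fin n → Fin 2) (Fin n → Fin 2) ℂ) :
    ∑ z, (pauliN n z * A).trace • pauliN n z = (2 ^ n : ℂ) • A := by
  ext c d
  simp only [Matrix.sum_apply, Matrix.smul_apply, Matrix.trace, Matrix.diag_apply,
    Matrix.mul_apply, smul_eq_mul, Finset.sum_mul]
  rw [Finset.sum_comm]
  simp_rw [Finset.sum_comm (s := (Finset.univ : Finset (Fin n → Fin 4)))]
  have key (a b : Fin n → Fin 2) :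
      ∑ z, pauliN n z a b * A b a * pauliN n z c d =
        if a = d ∧ b = c then 2 ^ n * A c d else 0 := by
    simp_rw [mul_right_comm _ (A b a), ← Finset.sum_mul, sum_pauliN_mul_pauliN]
    split_ifs with h
    · rw [h.1, h.2]
    · simp
  simp [key, ite_and]

theorem sum_trace_pauliN_mul_trace (A B : Matrix (Fin n → Fin 2) (Fin n → Fin 2) ℂ) :
    ∑ z, (pauliN n z * A).trace * (pauliN n z * B).trace = 2 ^ n * (A * B).trace := by
  have h := congrArg (fun C => (C * B).trace) (sum_trace_smul_pauliN A)
  simpa [Finset.sum_mul, Matrix.trace_sum] using h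

variable {U : Matrix (Fin n → Fin 2) (Fin n → Fin 2) ℂ}

theorem ofReal_repU (z x : Fin n → Fin 4) :
    (repU U z x : ℂ) = (1 / 2 ^ n : ℂ) * (pauliN n z * (U * pauliN n x * Uᴴ)).trace := by
  refine Complex.conj_eq_iff_re.1 ?_
  have h : star (pauliN n z * (U * pauliN n x * Uᴴ)).trace =
      (pauliN n z * (U * pauliN n x * Uᴴ)).trace := by
    rw [← Matrix.trace_conjTranspose]
    simp only [Matrix.conjTranspose_mul, Matrix.conjTranspose_conjTranspose, pauliN_conjTranspose]
    rw [Matrix.trace_mul_comm, Matrix.mul_assoc U]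
  rw [map_mul, starRingEnd_apply (_ : ℂ), starRingEnd_apply (_ : ℂ), h]
  simp

theorem repU_conjTranspose (z x : Fin n → Fin 4) : repU Uᴴ z x = repU U x z := by
  simp only [repU, Matrix.of_apply, Matrix.conjTranspose_conjTranspose]
  rw [← Matrix.mul_assoc, ← Matrix.mul_assoc, Matrix.mul_assoc (pauliN n z * Uᴴ),
    Matrix.trace_mul_comm, Matrix.mul_assoc, Matrix.mul_assoc]

theorem sum_repU_sq_col (hU : U * Uᴴ = 1) (hU' : Uᴴ * U = 1) (x : Fin n → Fin 4) :
    ∑ z, repU U z x ^ 2 = 1 := by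
  have hsq : U * pauliN n x * Uᴴ * (U * pauliN n x * Uᴴ) = 1 := by
    calc _ = U * pauliN n x * (Uᴴ * U) * pauliN n x * Uᴴ := by simp only [Matrix.mul_assoc]
      _ = U * (pauliN n x * pauliN n x) * Uᴴ := by simp [hU', Matrix.mul_assoc]
      _ = 1 := by rw [pauliN_mul_self, Matrix.mul_one, hU]
  have h := sum_trace_pauliN_mul_trace (U * pauliN n x * Uᴴ) (U * pauliN n x * Uᴴ)
  rw [hsq, Matrix.trace_one] at h
  apply Complex.ofReal_injective
  push_cast
  simp_rw [ofReal_repU, mul_pow, ← Finset.mul_sum, sq (Matrix.trace _), h]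
  simp
  field_simp

theorem sum_repU_sq_row (hU : U * Uᴴ = 1) (hU' : Uᴴ * U = 1) (z : Fin n → Fin 4) :
    ∑ x, repU U z x ^ 2 = 1 := by
  simp_rw [← repU_conjTranspose (U := U)]
  exact sum_repU_sq_col (by simpa using hU') (by simpa using hU) z

theorem repU_zero_zero (hU : U * Uᴴ = 1) : repU U (fun _ => 0) (fun _ => 0) = 1 := by
  apply Complex.ofReal_injective
  rw [ofReal_repU, pauliN_zero]
  simp [hU]

theorem sum_repU_smul_pauliN (x : Fin n → Fin 4) :
    ∑ z, (repU U z x : ℂ) • pauliN n z = U * pauliN n x * Uᴴ := by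
  simp_rw [ofReal_repU, mul_smul]
  rw [← Finset.smul_sum, sum_trace_smul_pauliN, smul_smul]
  simp

theorem isCliffordU_iff_repU (hU : U * Uᴴ = 1) (hU' : Uᴴ * U = 1) :
    IsCliffordU U ↔ ∀ z x, repU U z x = 0 ∨ |repU U z x| = 1 := by
  constructor
  · intro h z x
    obtain ⟨w, s, hs, hw⟩ := h x
    have hzx : repU U z x = if z = w then s else 0 := by
      apply Complex.ofReal_injective
      rw [ofReal_repU, hw, Matrix.mul_smul, Matrix.trace_smul, trace_pauliN_mul]
      split_ifs <;> simp
      field_simp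
    rw [hzx]
    split_ifs
    · rcases hs with rfl | rfl <;> simp
    · simp
  · intro h x
    obtain ⟨z, hz⟩ := exists_ne_zero_of_sum_sq_eq_one (sum_repU_sq_col hU hU' x)
    have habs := (h z x).resolve_left hz
    refine ⟨z, repU U z x, eq_or_eq_neg_of_abs_eq habs, ?_⟩
    rw [← sum_repU_smul_pauliN]
    refine Finset.sum_eq_single z (fun w _ hw => ?_) (by simp)
    rw [eq_zero_of_sum_sq_eq_one (w := fun z => repU U z x) (sum_repU_sq_col hU hU' x) habs hw]
    simp

end Pauli

/-- Faithfulness of the `(p,q)` group norm of the Pauli-basis representation matrix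
of a unitary as a magic measure: (1) for `0 < p < 2`, `‖M^U‖_{p,q} ≥ 1` with equality
iff `U` is Clifford; (2) for `p > 2`, `0 < q < ∞`, `‖M^U‖_{p,q} ≤ 1` with equality iff
`U` is Clifford; (3) for `p = 2` (any `q > 0`) and for `p > 2, q = ∞`, `‖M^U‖_{p,q} = 1`. -/
theorem statement10 (n : ℕ) (hn : 1 ≤ n)
    (U : Matrix (Fin n → Fin 2) (Fin n → Fin 2) ℂ)
    (hU : U * Uᴴ = 1) (hU' : Uᴴ * U = 1) :
    (∀ p q : ℝ≥0∞, 0 < p → p < 2 → 0 < q →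
      1 ≤ groupNorm p q (repU U) ∧ (groupNorm p q (repU U) = 1 ↔ IsCliffordU U)) ∧
    (∀ p q : ℝ≥0∞, 2 < p → 0 < q → q < ∞ →
      groupNorm p q (repU U) ≤ 1 ∧ (groupNorm p q (repU U) = 1 ↔ IsCliffordU U)) ∧
    (∀ q : ℝ≥0∞, 0 < q → groupNorm 2 q (repU U) = 1) ∧
    (∀ p : ℝ≥0∞, 2 < p → groupNorm p ∞ (repU U) = 1) := by
  have hrow (z : Fin n → Fin 4) : ∑ x, repU U z x ^ 2 = 1 := sum_repU_sq_row hU hU' z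
  refine ⟨fun p q hp hp2 hq => ?_, fun p q hp hq hqt => ?_, fun q hq => ?_, fun p hp => ?_⟩
  · obtain ⟨hle, heq⟩ := one_le_groupNorm hq fun z => (one_le_vecLpNorm (hrow z) hp hp2).1
    refine ⟨hle, heq.trans ?_⟩
    rw [isCliffordU_iff_repU hU hU']
    exact forall_congr' fun z => (one_le_vecLpNorm (hrow z) hp hp2).2
  · obtain ⟨hle, heq⟩ := groupNorm_le_one hq hqt.ne fun z => (vecLpNorm_le_one (hrow z) hp).1
    refine ⟨hle, heq.trans ?_⟩
    rw [isCliffordU_iff_repU hU hU']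
    exact forall_congr' fun z => (vecLpNorm_le_one (hrow z) hp).2
  · have h2 (z : Fin n → Fin 4) := vecLpNorm_two (hrow z)
    exact (one_le_groupNorm hq fun z => (h2 z).ge).2.2 h2
  · rw [groupNorm, if_pos rfl]
    refine le_antisymm (ciSup_le fun z => (vecLpNorm_le_one (hrow z) hp).1) ?_
    have h00 : |repU U (fun _ => 0) (fun _ => 0)| = 1 := by rw [repU_zero_zero hU, abs_one]
    have h0 : vecLpNorm p (repU U fun _ => 0) = 1 := by
      refine (vecLpNorm_le_one (hrow _) hp).2.2 fun x => ?_
      by_cases hx : x = fun _ => 0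
      · exact Or.inr (hx ▸ h00)
      · exact Or.inl (eq_zero_of_sum_sq_eq_one (hrow _) h00 hx)
    rw [← h0]
    exact le_ciSup (f := fun z => vecLpNorm p (repU U z)) (Set.finite_range _).bddAbove _
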